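/- arXiv:1510.03906 — 3 statements merged into one kernel-verified Lean document; each statement's English description precedes it below -/
import Mathlib

section
/- Let u₁, u₂ : ℝ² → ℂ be smooth solutions of the second A₂⁽¹⁾-KdV flow, let k ∈ ℂ, and let φ₁, φ₂ : ℝ² → ℂ be smooth functions satisfying, for i = 1, 2: ∂ₓ³φᵢ − u₂·∂ₓφᵢ − u₁·φᵢ = k·φᵢ and ∂ₜφᵢ = −(2/3)u₂·φᵢ + ∂ₓ²φᵢ. Suppose the Wronskian W := φ₁·∂ₓφ₂ − φ₂·∂ₓφ₁ is nowhere zero on ℝ². Then h := (∂ₓW)/W is a solution of (BT)_{(u₁,u₂),k}. -/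
/-- Partial derivative in the first (space) variable. -/
noncomputable def px (f : ℝ × ℝ → ℂ) : ℝ × ℝ → ℂ :=
  fun p => deriv (fun x => f (x, p.2)) p.1

/-- Partial derivative in the second (time) variable. -/
noncomputable def pt (f : ℝ × ℝ → ℂ) : ℝ × ℝ → ℂ :=
  fun p => deriv (fun t => f (p.1, t)) p.2

/-- The second A₂⁽¹⁾-KdV flow. -/
def IsKdV2 (u₁ u₂ : ℝ × ℝ → ℂ) : Prop :=
  (∀ p, pt u₁ p = px (px u₁) p - (2/3 : ℂ) * px (px (px u₂)) p
      + (2/3 : ℂ) * (u₂ p * px u₂ p)) ∧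
  (∀ p, pt u₂ p = -(px (px u₂) p) + 2 * px u₁ p)

/-- The system (BT)_{(u₁,u₂),k}. -/
def IsBT (u₁ u₂ : ℝ × ℝ → ℂ) (k : ℂ) (h : ℝ × ℝ → ℂ) : Prop :=
  (∀ p, px (px h) p = -u₁ p + px u₂ p + h p * u₂ p - 3 * h p * px h p - (h p) ^ 3 - k) ∧
  (∀ p, pt h p = (2/3 : ℂ) * px u₂ p - px (px h) p - 2 * h p * px h p)

/-- The Bäcklund transformation `h ∗ (u₁, u₂)`. -/
noncomputable def btStar (h u₁ u₂ : ℝ × ℝ → ℂ) : (ℝ × ℝ → ℂ) × (ℝ × ℝ → ℂ) :=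
  (fun p => u₁ p - px u₂ p + 3 * h p * px h p, fun p => u₂ p - 3 * px h p)

abbrev Sm (f : ℝ × ℝ → ℂ) : Prop := ContDiff ℝ (⊤ : ℕ∞) f

lemma Sm.diff {f : ℝ × ℝ → ℂ} (hf : Sm f) : Differentiable ℝ f :=
  hf.differentiable (by simp)

lemma Sm.hasx {f : ℝ × ℝ → ℂ} (hf : Sm f) (p : ℝ × ℝ) :
    HasDerivAt (fun x => f (x, p.2)) (fderiv ℝ f p (1, 0)) p.1 := by
  have h1 : HasFDerivAt f (fderiv ℝ f p) (p.1, p.2) := (hf.diff p).hasFDerivAt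
  have h2 : HasDerivAt (fun x : ℝ => (x, p.2)) ((1 : ℝ), (0 : ℝ)) p.1 :=
    (hasDerivAt_id p.1).prodMk (hasDerivAt_const p.1 p.2)
  exact h1.comp_hasDerivAt p.1 h2

lemma Sm.hast {f : ℝ × ℝ → ℂ} (hf : Sm f) (p : ℝ × ℝ) :
    HasDerivAt (fun t => f (p.1, t)) (fderiv ℝ f p (0, 1)) p.2 := by
  have h1 : HasFDerivAt f (fderiv ℝ f p) (p.1, p.2) := (hf.diff p).hasFDerivAt
  have h2 : HasDerivAt (fun x : ℝ => (p.1, x)) ((0 : ℝ), (1 : ℝ)) p.2 :=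
    (hasDerivAt_const p.2 p.1).prodMk (hasDerivAt_id p.2)
  exact h1.comp_hasDerivAt p.2 h2

lemma Sm.px_eq {f : ℝ × ℝ → ℂ} (hf : Sm f) : px f = fun p => fderiv ℝ f p (1, 0) :=
  funext fun p => (hf.hasx p).deriv

lemma Sm.pt_eq {f : ℝ × ℝ → ℂ} (hf : Sm f) : pt f = fun p => fderiv ℝ f p (0, 1) :=
  funext fun p => (hf.hast p).deriv

lemma Sm.fd {f : ℝ × ℝ → ℂ} (hf : Sm f) : ContDiff ℝ (⊤ : ℕ∞) (fderiv ℝ f) :=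
  hf.fderiv_right (by simp)

lemma Sm.px {f : ℝ × ℝ → ℂ} (hf : Sm f) : Sm (px f) := by
  rw [hf.px_eq]; exact hf.fd.clm_apply contDiff_const

lemma Sm.pt {f : ℝ × ℝ → ℂ} (hf : Sm f) : Sm (pt f) := by
  rw [hf.pt_eq]; exact hf.fd.clm_apply contDiff_const

lemma Sm.comm {f : ℝ × ℝ → ℂ} (hf : Sm f) (p : ℝ × ℝ) : _root_.pt (_root_.px f) p = _root_.px (_root_.pt f) p := by
  have hd : DifferentiableAt ℝ (fderiv ℝ f) p := hf.fd.differentiable (by simp) p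
  rw [hf.px.pt_eq, hf.pt.px_eq, hf.px_eq, hf.pt_eq]
  have hs : IsSymmSndFDerivAt ℝ f p := hf.contDiffAt.isSymmSndFDerivAt
    (by simp only [minSmoothness_of_isRCLikeNormedField]; exact WithTop.coe_le_coe.2 le_top)
  have := hs (0, 1) (1, 0)
  simp only
  rw [fderiv_clm_apply hd (by fun_prop), fderiv_clm_apply hd (by fun_prop)]
  simpa using this

lemma Sm.dx {f : ℝ × ℝ → ℂ} (hf : Sm f) (p : ℝ × ℝ) :
    HasDerivAt (fun x => f (x, p.2)) (_root_.px f p) p.1 := by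
  rw [hf.px_eq]; exact hf.hasx p

lemma Sm.dt {f : ℝ × ℝ → ℂ} (hf : Sm f) (p : ℝ × ℝ) :
    HasDerivAt (fun t => f (p.1, t)) (_root_.pt f p) p.2 := by
  rw [hf.pt_eq]; exact hf.hast p

/-- Solutions of the linear system (scalar Lax pair at λ = k) with nonvanishing
Wronskian produce a solution `h = (ln W)ₓ = Wₓ/W` of (BT)_{(u₁,u₂),k}. -/
theorem stmt6 (u₁ u₂ φ₁ φ₂ : ℝ × ℝ → ℂ) (k : ℂ)
    (hu₁ : ContDiff ℝ (⊤ : ℕ∞) u₁) (hu₂ : ContDiff ℝ (⊤ : ℕ∞) u₂)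
    (hφ₁ : ContDiff ℝ (⊤ : ℕ∞) φ₁) (hφ₂ : ContDiff ℝ (⊤ : ℕ∞) φ₂)
    (hKdV : IsKdV2 u₁ u₂)
    (hx1 : ∀ p, px (px (px φ₁)) p - u₂ p * px φ₁ p - u₁ p * φ₁ p = k * φ₁ p)
    (ht1 : ∀ p, pt φ₁ p = -(2/3 : ℂ) * u₂ p * φ₁ p + px (px φ₁) p)
    (hx2 : ∀ p, px (px (px φ₂)) p - u₂ p * px φ₂ p - u₁ p * φ₂ p = k * φ₂ p)
    (ht2 : ∀ p, pt φ₂ p = -(2/3 : ℂ) * u₂ p * φ₂ p + px (px φ₂) p)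
    (W : ℝ × ℝ → ℂ) (hW : ∀ p, W p = φ₁ p * px φ₂ p - φ₂ p * px φ₁ p)
    (hWne : ∀ p, W p ≠ 0) :
    IsBT u₁ u₂ k (fun p => px W p / W p) := by
  obtain rfl : W = fun p => φ₁ p * px φ₂ p - φ₂ p * px φ₁ p := funext hW
  set W : ℝ × ℝ → ℂ := fun p => φ₁ p * px φ₂ p - φ₂ p * px φ₁ p with hWdef
  have sW : Sm W := (hφ₁.mul (Sm.px hφ₂)).sub (hφ₂.mul (Sm.px hφ₁))
  have d1 := Sm.dx hφ₁
  have d2 := Sm.dx hφ₂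
  have d1' := Sm.dx (Sm.px hφ₁)
  have d2' := Sm.dx (Sm.px hφ₂)
  have d1'' := Sm.dx (Sm.px (Sm.px hφ₁))
  have d2'' := Sm.dx (Sm.px (Sm.px hφ₂))
  have du := Sm.dx hu₂
  have W1 : px W = fun p => φ₁ p * px (px φ₂) p - φ₂ p * px (px φ₁) p := by
    funext p
    refine (((d1 p).mul (d2' p)).sub ((d2 p).mul (d1' p))).deriv.trans ?_
    ring
  have W2 : px (px W) = fun p => px φ₁ p * px (px φ₂) p - px φ₂ p * px (px φ₁) p
      + u₂ p * W p := by
    rw [W1]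
    funext p
    refine (((d1 p).mul (d2'' p)).sub ((d2 p).mul (d1'' p))).deriv.trans ?_
    simp only [hWdef]
    linear_combination φ₁ p * hx2 p - φ₂ p * hx1 p
  have W3 : ∀ p, px (px (px W)) p = -(u₁ p + k) * W p + px u₂ p * W p + u₂ p * px W p := by
    intro p
    rw [W2]
    refine ((((d1' p).mul (d2'' p)).sub ((d2' p).mul (d1'' p))).add
      ((du p).mul (sW.dx p))).deriv.trans ?_
    simp only [hWdef]
    linear_combination px φ₁ p * hx2 p - px φ₂ p * hx1 p
  have mixed : ∀ (φ : ℝ × ℝ → ℂ), Sm φ →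
      (∀ p, pt φ p = -(2/3 : ℂ) * u₂ p * φ p + px (px φ) p) → ∀ p,
      pt (px φ) p = -(2/3 : ℂ) * (px u₂ p * φ p + u₂ p * px φ p) + px (px (px φ)) p := by
    intro φ hφ ht p
    rw [hφ.comm, show pt φ = _ from funext ht]
    refine ((((du p).const_mul (-(2/3 : ℂ))).mul (hφ.dx p)).add (hφ.px.px.dx p)).deriv.trans ?_
    ring
  have Wt : pt W = fun p => (2/3 : ℂ) * (u₂ p * W p) - px (px W) p := by
    funext p
    refine ((((Sm.dt hφ₁ p).mul (Sm.dt (Sm.px hφ₂) p)).sub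
      ((Sm.dt hφ₂ p).mul (Sm.dt (Sm.px hφ₁) p)))).deriv.trans ?_
    rw [W2]
    simp only [hWdef, mixed φ₁ hφ₁ ht1, mixed φ₂ hφ₂ ht2, ht1, ht2]
    linear_combination φ₁ p * hx2 p - φ₂ p * hx1 p
  have Wxt : ∀ p, pt (px W) p = (2/3 : ℂ) * (px u₂ p * W p + u₂ p * px W p)
      - px (px (px W)) p := by
    intro p
    rw [sW.comm, Wt]
    exact ((((du p).mul (sW.dx p)).const_mul (2/3 : ℂ)).sub (sW.px.px.dx p)).deriv
  clear_value W
  have h1 : px (fun p => px W p / W p) =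
      fun p => (px (px W) p * W p - px W p * px W p) / W p ^ 2 := by
    funext p
    exact ((sW.px.dx p).div (sW.dx p) (hWne p)).deriv
  have h2 : ∀ p, px (px (fun p => px W p / W p)) p =
      px (px (px W)) p / W p - 3 * px (px W) p * px W p / W p ^ 2
        + 2 * px W p ^ 3 / W p ^ 3 := by
    intro p
    have hp := hWne p
    rw [h1]
    refine (((((sW.px.px.dx p).mul (sW.dx p)).sub ((sW.px.dx p).mul (sW.px.dx p)))).div
      ((sW.dx p).pow 2) (pow_ne_zero 2 hp)).deriv.trans ?_
    simp only [Pi.mul_apply, Pi.sub_apply, Pi.pow_apply, Prod.mk.eta]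
    field_simp
    push_cast
    ring
  have h3 : ∀ p, pt (fun p => px W p / W p) p =
      (pt (px W) p * W p - px W p * pt W p) / W p ^ 2 := by
    intro p
    exact ((sW.px.dt p).div (sW.dt p) (hWne p)).deriv
  refine ⟨fun p => ?_, fun p => ?_⟩
  · have hp := hWne p
    rw [h2, h1, W3]
    field_simp
    ring
  · have hp := hWne p
    rw [h3, h2, h1, Wxt, Wt]
    field_simp
    ring
end

section
/- Let u₁, u₂ : ℝ² → ℂ be smooth solutions of the second A₂⁽¹⁾-KdV flow, let k₁, k₂ ∈ ℂ, let h₁ be a smooth solution of (BT)_{(u₁,u₂),k₁} and h₂ a smooth solution of (BT)_{(u₁,u₂),k₂}, and assume h₁ − h₂ is nowhere zero on ℝ². Then h̃₁ := h₁ + ∂ₓ(h₁−h₂)/(h₁−h₂) is a solution of (BT)_{h₂∗(u₁,u₂), k₁}, and h̃₂ := h₂ + ∂ₓ(h₁−h₂)/(h₁−h₂) is a solution of (BT)_{h₁∗(u₁,u₂), k₂}. -/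
theorem smooth_px_aux {f : ℝ × ℝ → ℂ} (hf : ContDiff ℝ (⊤ : ℕ∞) f) (p : ℝ × ℝ) :
    HasDerivAt (fun x => f (x, p.2)) (fderiv ℝ f p (1, 0)) p.1 := by
  have h1 : HasFDerivAt f (fderiv ℝ f p) (p.1, p.2) :=
    (hf.differentiable (by simp) p).hasFDerivAt
  have h2 : HasDerivAt (fun x : ℝ => (x, p.2)) ((1 : ℝ), (0 : ℝ)) p.1 :=
    (hasDerivAt_id p.1).prodMk (hasDerivAt_const p.1 p.2)
  exact h1.comp_hasDerivAt p.1 h2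

theorem smooth_pt_aux {f : ℝ × ℝ → ℂ} (hf : ContDiff ℝ (⊤ : ℕ∞) f) (p : ℝ × ℝ) :
    HasDerivAt (fun t => f (p.1, t)) (fderiv ℝ f p (0, 1)) p.2 := by
  have h1 : HasFDerivAt f (fderiv ℝ f p) (p.1, p.2) :=
    (hf.differentiable (by simp) p).hasFDerivAt
  have h2 : HasDerivAt (fun t : ℝ => (p.1, t)) ((0 : ℝ), (1 : ℝ)) p.2 :=
    (hasDerivAt_const p.2 p.1).prodMk (hasDerivAt_id p.2)
  exact h1.comp_hasDerivAt p.2 h2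

theorem px_eq_fderiv {f : ℝ × ℝ → ℂ} (hf : ContDiff ℝ (⊤ : ℕ∞) f) :
    px f = fun p => fderiv ℝ f p (1, 0) := funext fun p => (smooth_px_aux hf p).deriv

theorem pt_eq_fderiv {f : ℝ × ℝ → ℂ} (hf : ContDiff ℝ (⊤ : ℕ∞) f) :
    pt f = fun p => fderiv ℝ f p (0, 1) := funext fun p => (smooth_pt_aux hf p).deriv

theorem hasDerivAt_px {f : ℝ × ℝ → ℂ} (hf : ContDiff ℝ (⊤ : ℕ∞) f) (p : ℝ × ℝ) :
    HasDerivAt (fun x => f (x, p.2)) (px f p) p.1 := by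
  rw [px_eq_fderiv hf]; exact smooth_px_aux hf p

theorem hasDerivAt_pt {f : ℝ × ℝ → ℂ} (hf : ContDiff ℝ (⊤ : ℕ∞) f) (p : ℝ × ℝ) :
    HasDerivAt (fun t => f (p.1, t)) (pt f p) p.2 := by
  rw [pt_eq_fderiv hf]; exact smooth_pt_aux hf p

theorem smooth_fderiv_apply {f : ℝ × ℝ → ℂ} (hf : ContDiff ℝ (⊤ : ℕ∞) f) (v : ℝ × ℝ) :
    ContDiff ℝ (⊤ : ℕ∞) (fun p => fderiv ℝ f p v) :=
  (hf.fderiv_right (m := ((⊤ : ℕ∞) : WithTop ℕ∞)) (by simp)).clm_apply contDiff_const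

theorem smooth_px {f : ℝ × ℝ → ℂ} (hf : ContDiff ℝ (⊤ : ℕ∞) f) :
    ContDiff ℝ (⊤ : ℕ∞) (px f) := by
  rw [px_eq_fderiv hf]; exact smooth_fderiv_apply hf _

theorem smooth_pt {f : ℝ × ℝ → ℂ} (hf : ContDiff ℝ (⊤ : ℕ∞) f) :
    ContDiff ℝ (⊤ : ℕ∞) (pt f) := by
  rw [pt_eq_fderiv hf]; exact smooth_fderiv_apply hf _

theorem pt_px_comm {f : ℝ × ℝ → ℂ} (hf : ContDiff ℝ (⊤ : ℕ∞) f) (p : ℝ × ℝ) :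
    pt (px f) p = px (pt f) p := by
  rw [pt_eq_fderiv (smooth_px hf), px_eq_fderiv (smooth_pt hf), px_eq_fderiv hf,
    pt_eq_fderiv hf]
  have hd : DifferentiableAt ℝ (fderiv ℝ f) p :=
    (hf.fderiv_right (m := ((⊤ : ℕ∞) : WithTop ℕ∞)) (by simp)).differentiable (by simp) p
  have hs : IsSymmSndFDerivAt ℝ f p :=
    hf.contDiffAt.isSymmSndFDerivAt (by
      simp only [minSmoothness_of_isRCLikeNormedField]; exact WithTop.coe_le_coe.mpr (le_top : (2 : ℕ∞) ≤ ⊤))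
  have e : ∀ v w : ℝ × ℝ, fderiv ℝ (fun q => fderiv ℝ f q v) p w
      = fderiv ℝ (fderiv ℝ f) p w v := by
    intro v w
    rw [fderiv_clm_apply hd (differentiableAt_const v)]
    simp
  simp only [e]
  exact hs.eq _ _

/-- The third derivative of a solution. -/
theorem bt_third {u v h : ℝ × ℝ → ℂ} {k : ℂ}
    (hu : ContDiff ℝ (⊤ : ℕ∞) u) (hv : ContDiff ℝ (⊤ : ℕ∞) v) (hh : ContDiff ℝ (⊤ : ℕ∞) h)
    (hB : IsBT u v k h) (p : ℝ × ℝ) :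
    px (px (px h)) p = -px u p + px (px v) p + (px h p * v p + h p * px v p)
      - 3 * (px h p * px h p + h p * px (px h) p) - 3 * h p ^ 2 * px h p := by
  have e : px (px h) = fun p => -u p + px v p + h p * v p - 3 * (h p * px h p) - (h p) ^ 3 - k := by
    funext q; rw [hB.1 q]; ring
  have H := hasDerivAt_px hh p
  have := ((((((hasDerivAt_px hu p).neg.add (hasDerivAt_px (smooth_px hv) p)).add
    (H.mul (hasDerivAt_px hv p))).sub ((H.mul (hasDerivAt_px (smooth_px hh) p)).const_mul 3)).sub
    (H.pow 3)).sub_const k).deriv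
  have e2 : px (px (px h)) p = deriv (fun x => (fun p => -u p + px v p + h p * v p
      - 3 * (h p * px h p) - (h p) ^ 3 - k) (x, p.2)) p.1 := by
    conv_lhs => rw [px, e]
  rw [e2]
  refine Eq.trans this ?_
  push_cast
  ring

theorem bt_mixed {u v h : ℝ × ℝ → ℂ} {k : ℂ}
    (hv : ContDiff ℝ (⊤ : ℕ∞) v) (hh : ContDiff ℝ (⊤ : ℕ∞) h)
    (hB : IsBT u v k h) (p : ℝ × ℝ) :
    pt (px h) p = (2/3 : ℂ) * px (px v) p - px (px (px h)) p
      - 2 * (px h p * px h p + h p * px (px h) p) := by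
  rw [pt_px_comm hh]
  have e : pt h = fun p => (2/3 : ℂ) * px v p - px (px h) p - 2 * (h p * px h p) := by
    funext q; rw [hB.2 q]; ring
  have h1 := hasDerivAt_px (smooth_px hh) p
  have := (((hasDerivAt_px (smooth_px hv) p).const_mul (2/3 : ℂ)).sub
    (hasDerivAt_px (smooth_px (smooth_px hh)) p)).sub
    (((hasDerivAt_px hh p).mul h1).const_mul 2)
  rw [e]
  exact this.deriv

theorem bt_half (u v a b : ℝ × ℝ → ℂ) (k l : ℂ)
    (hu : ContDiff ℝ (⊤ : ℕ∞) u) (hv : ContDiff ℝ (⊤ : ℕ∞) v)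
    (ha : ContDiff ℝ (⊤ : ℕ∞) a) (hb : ContDiff ℝ (⊤ : ℕ∞) b)
    (hA : IsBT u v k a) (hB : IsBT u v l b)
    (hne : ∀ p, a p - b p ≠ 0) :
    IsBT (btStar b u v).1 (btStar b u v).2 k
        (fun p => a p + px (fun q => a q - b q) p / (a p - b p)) := by
  have ha1 := smooth_px ha
  have hb1 := smooth_px hb
  have ha2 := smooth_px ha1
  have hb2 := smooth_px hb1
  have e0 : px (fun q => a q - b q) = fun p => px a p - px b p := by
    funext p; exact ((hasDerivAt_px ha p).sub (hasDerivAt_px hb p)).deriv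
  have e1 : px (fun p => a p + (px a p - px b p) / (a p - b p)) = fun p =>
      px a p + ((px (px a) p - px (px b) p) * (a p - b p)
        - (px a p - px b p) * (px a p - px b p)) / (a p - b p) ^ 2 := by
    funext p
    exact ((hasDerivAt_px ha p).add (((hasDerivAt_px ha1 p).sub (hasDerivAt_px hb1 p)).div
      ((hasDerivAt_px ha p).sub (hasDerivAt_px hb p)) (hne p))).deriv
  have e2 : ∀ p, px (px (fun p => a p + (px a p - px b p) / (a p - b p))) p =
      px (px a) p + ((((px (px (px a)) p - px (px (px b)) p) * (a p - b p)
        + (px (px a) p - px (px b) p) * (px a p - px b p))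
        - ((px (px a) p - px (px b) p) * (px a p - px b p)
        + (px a p - px b p) * (px (px a) p - px (px b) p))) * (a p - b p) ^ 2
        - ((px (px a) p - px (px b) p) * (a p - b p)
        - (px a p - px b p) * (px a p - px b p)) *
          (2 * (a p - b p) * (px a p - px b p))) / ((a p - b p) ^ 2) ^ 2 := by
    intro p
    rw [e1]
    have d0 := (hasDerivAt_px ha p).sub (hasDerivAt_px hb p)
    have d1 := (hasDerivAt_px ha1 p).sub (hasDerivAt_px hb1 p)
    have d2 := (hasDerivAt_px ha2 p).sub (hasDerivAt_px hb2 p)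
    have := ((hasDerivAt_px ha1 p).add (((d2.mul d0).sub (d1.mul d1)).div (d0.pow 2)
      (pow_ne_zero 2 (hne p)))).deriv
    refine Eq.trans this ?_
    simp
  have e3 : ∀ p, pt (fun p => a p + (px a p - px b p) / (a p - b p)) p =
      pt a p + ((pt (px a) p - pt (px b) p) * (a p - b p)
        - (px a p - px b p) * (pt a p - pt b p)) / (a p - b p) ^ 2 := by
    intro p
    exact ((hasDerivAt_pt ha p).add (((hasDerivAt_pt ha1 p).sub (hasDerivAt_pt hb1 p)).div
      ((hasDerivAt_pt ha p).sub (hasDerivAt_pt hb p)) (hne p))).deriv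
  have e4 : ∀ p, px (fun p => v p - 3 * px b p) p = px v p - 3 * px (px b) p := by
    intro p
    exact ((hasDerivAt_px hv p).sub ((hasDerivAt_px hb1 p).const_mul 3)).deriv
  rw [e0]
  refine ⟨fun p => ?_, fun p => ?_⟩
  · rw [e2 p]
    simp only [btStar, e4, e1]
    rw [bt_third hu hv ha hA p, bt_third hu hv hb hB p, hA.1 p, hB.1 p]
    have := hne p
    field_simp
    ring
  · rw [e2 p, e3 p]
    simp only [btStar, e4, e1]
    rw [bt_mixed hv ha hA p, bt_mixed hv hb hB p, bt_third hu hv ha hA p,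
      bt_third hu hv hb hB p, hA.2 p, hB.2 p, hA.1 p, hB.1 p]
    have := hne p
    field_simp
    ring

/-- Permutability for Bäcklund transformations, part (i). -/
theorem stmt8 (u₁ u₂ h₁ h₂ : ℝ × ℝ → ℂ) (k₁ k₂ : ℂ)
    (hu₁ : ContDiff ℝ (⊤ : ℕ∞) u₁) (hu₂ : ContDiff ℝ (⊤ : ℕ∞) u₂)
    (hh₁ : ContDiff ℝ (⊤ : ℕ∞) h₁) (hh₂ : ContDiff ℝ (⊤ : ℕ∞) h₂)
    (hKdV : IsKdV2 u₁ u₂)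
    (hBT₁ : IsBT u₁ u₂ k₁ h₁) (hBT₂ : IsBT u₁ u₂ k₂ h₂)
    (hne : ∀ p, h₁ p - h₂ p ≠ 0) :
    IsBT (btStar h₂ u₁ u₂).1 (btStar h₂ u₁ u₂).2 k₁
        (fun p => h₁ p + px (fun q => h₁ q - h₂ q) p / (h₁ p - h₂ p)) ∧
    IsBT (btStar h₁ u₁ u₂).1 (btStar h₁ u₁ u₂).2 k₂
        (fun p => h₂ p + px (fun q => h₁ q - h₂ q) p / (h₁ p - h₂ p)) := by
  refine ⟨bt_half u₁ u₂ h₁ h₂ k₁ k₂ hu₁ hu₂ hh₁ hh₂ hBT₁ hBT₂ hne, ?_⟩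
  have H := bt_half u₁ u₂ h₂ h₁ k₂ k₁ hu₁ hu₂ hh₂ hh₁ hBT₂ hBT₁
    (fun p => by rw [← neg_sub]; exact neg_ne_zero.mpr (hne p))
  convert H using 3 with p
  have x1 : px (fun q => h₁ q - h₂ q) p = px h₁ p - px h₂ p :=
    ((hasDerivAt_px hh₁ p).sub (hasDerivAt_px hh₂ p)).deriv
  have x2 : px (fun q => h₂ q - h₁ q) p = px h₂ p - px h₁ p :=
    ((hasDerivAt_px hh₂ p).sub (hasDerivAt_px hh₁ p)).deriv
  rw [x1, x2, ← neg_sub (px h₁ p), ← neg_sub (h₁ p), neg_div_neg_eq]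
end

section
/- Let u₁, u₂ : ℝ² → ℂ and h : ℝ² → ℂ be smooth, let r ∈ ℝ with r ≠ 0, and define (r·u)₁(x,t) = r³·u₁(rx, r²t), (r·u)₂(x,t) = r²·u₂(rx, r²t) and ĥ(x,t) = r⁻¹·h(r⁻¹x, r⁻²t). Let (w₁, w₂) = h∗((r·u)₁,(r·u)₂). Then (x,t) ↦ r⁻³·w₁(r⁻¹x, r⁻²t) equals the first component of ĥ∗(u₁,u₂), and (x,t) ↦ r⁻²·w₂(r⁻¹x, r⁻²t) equals the second component of ĥ∗(u₁,u₂); that is, the inverse scaling of h∗(r·u) equals ĥ∗u. -/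
theorem px_scale (f g : ℝ × ℝ → ℂ) (c : ℂ) (a b : ℝ)
    (hg : ∀ p, g p = c * f (a * p.1, b * p.2)) (p : ℝ × ℝ) :
    px g p = c * ((a : ℂ) * px f (a * p.1, b * p.2)) := by
  have h1 : (fun x => g (x, p.2)) = fun x => c * (fun y => f (y, b * p.2)) (a * x) := by
    funext x
    simp [hg]
  simp only [px]
  rw [h1, deriv_const_mul_field,
    deriv_comp_mul_left a (fun y => f (y, b * p.2)) p.1, Complex.real_smul]

/-- The inverse scaling of `h ∗ (r·u)` equals `ĥ ∗ u`. -/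
theorem stmt12 (u₁ u₂ h : ℝ × ℝ → ℂ)
    (hu₁ : ContDiff ℝ (⊤ : ℕ∞) u₁) (hu₂ : ContDiff ℝ (⊤ : ℕ∞) u₂) (hh : ContDiff ℝ (⊤ : ℕ∞) h)
    (r : ℝ) (hr : r ≠ 0)
    (ru₁ ru₂ hhat : ℝ × ℝ → ℂ)
    (hru₁ : ∀ p, ru₁ p = (r : ℂ) ^ 3 * u₁ (r * p.1, r ^ 2 * p.2))
    (hru₂ : ∀ p, ru₂ p = (r : ℂ) ^ 2 * u₂ (r * p.1, r ^ 2 * p.2))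
    (hhhat : ∀ p, hhat p = (r : ℂ)⁻¹ * h (r⁻¹ * p.1, (r ^ 2)⁻¹ * p.2)) :
    (∀ p : ℝ × ℝ, ((r : ℂ) ^ 3)⁻¹ * (btStar h ru₁ ru₂).1 (r⁻¹ * p.1, (r ^ 2)⁻¹ * p.2) =
        (btStar hhat u₁ u₂).1 p) ∧
    (∀ p : ℝ × ℝ, ((r : ℂ) ^ 2)⁻¹ * (btStar h ru₁ ru₂).2 (r⁻¹ * p.1, (r ^ 2)⁻¹ * p.2) =
        (btStar hhat u₁ u₂).2 p) := by
  have hc : (r : ℂ) ≠ 0 := by exact_mod_cast hr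
  have e1 : ∀ x : ℝ, r * (r⁻¹ * x) = x := fun x => by field_simp
  have e2 : ∀ x : ℝ, r ^ 2 * ((r ^ 2)⁻¹ * x) = x := fun x => by field_simp
  have k1 := px_scale u₂ ru₂ _ _ _ hru₂
  have k2 := px_scale h hhat _ _ _ hhhat
  constructor
  · intro p
    simp only [btStar, k1, k2, hru₁, hhhat, e1, e2]
    push_cast
    field_simp
  · intro p
    simp only [btStar, k2, hru₂, e1, e2]
    push_cast
    field_simp
end
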